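/- Let n ≥ 3, 0 ≤ l < k ≤ n, let A = diag(a₁,…,aₙ) ∈ 𝒜_{k,l} be diagonal positive definite, set ℋ := (k−l)/(2H_k(A)), and let β > 0, C₀ > 0, s₀ > 1, ḡ(t) := 1 + C₀ t^{−β/2}. Then there exists C̃ > 1 (depending on A and β) such that for every c₁ > C̃ and every c₂ ∈ ℝ, the generalized symmetric function w_{c₁,c₂}(x) := c₂ + ∫_{s₀}^{s} ( η^{−ℋ}( ∫_1^η ℋ t^{ℋ−1} ḡ(t) dt + c₁ ) )^{1/(k−l)} dη (with s = ½xᵀAx) satisfies, for all x with ½xᵀAx ≥ 1 and all 1 ≤ m ≤ k: σ_m(λ(D²w_{c₁,c₂}(x))) ≥ σ_m(λ(A))(w'_{c₁,c₂}(s))^{m−1}( w'_{c₁,c₂}(s) + 2H_k(A) w''_{c₁,c₂}(s) s ) > 0; in particular λ(D²w_{c₁,c₂}(x)) ∈ Γ_k, i.e. w_{c₁,c₂} is uniformly k-convex on {x : ½xᵀAx ≥ 1}. -/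

import Mathlib

open scoped BigOperators
open Filter MeasureTheory

noncomputable section

/-- The `j`-th elementary symmetric function of `lam ∈ ℝⁿ`. -/
def esym (n j : ℕ) (lam : Fin n → ℝ) : ℝ :=
  ∑ S ∈ Finset.powersetCard j (Finset.univ : Finset (Fin n)), ∏ i ∈ S, lam i

/-- `σ_{j;i}`: the `j`-th elementary symmetric function with the `i`-th variable set to `0`. -/
def esymRem (n j : ℕ) (lam : Fin n → ℝ) (i : Fin n) : ℝ :=
  esym n j (Function.update lam i 0)

/-- The increasingly ordered eigenvalue vector of a real symmetric matrix
(junk value `0` if the matrix is not symmetric). -/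
def eigs {n : ℕ} (M : Matrix (Fin n) (Fin n) ℝ) : Fin n → ℝ :=
  if h : M.IsHermitian then h.eigenvalues ∘ (Tuple.sort h.eigenvalues) else 0

/-- The Hessian matrix `D²u(x)` of `u : ℝⁿ → ℝ`. -/
def hessianMatrix {n : ℕ} (u : EuclideanSpace ℝ (Fin n) → ℝ) (x : EuclideanSpace ℝ (Fin n)) :
    Matrix (Fin n) (Fin n) ℝ :=
  fun i j =>
    fderiv ℝ (fun y => fderiv ℝ u y (EuclideanSpace.single j 1)) x (EuclideanSpace.single i 1)

/-- The quadratic form `½ xᵀ A x`. -/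
def quadForm {n : ℕ} (A : Matrix (Fin n) (Fin n) ℝ) (x : EuclideanSpace ℝ (Fin n)) : ℝ :=
  (1 / 2) * ∑ i, ∑ j, A i j * x i * x j

/-- The Gårding cone `Γ_k = {λ : σ_j(λ) > 0, 1 ≤ j ≤ k}`. -/
def GammaK (n k : ℕ) : Set (Fin n → ℝ) :=
  {lam | ∀ j, 1 ≤ j → j ≤ k → 0 < esym n j lam}

/-- The Hessian quotient operator `S_{k,l}(M) = σ_k(λ(M))/σ_l(λ(M))`. -/
def Skl (n k l : ℕ) (M : Matrix (Fin n) (Fin n) ℝ) : ℝ :=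
  esym n k (eigs M) / esym n l (eigs M)

/-- `H_k(A) = max_i σ_{k-1;i}(λ(A)) λ_i(A) / σ_k(λ(A))`. -/
def Hk (n k : ℕ) (A : Matrix (Fin n) (Fin n) ℝ) : ℝ :=
  ⨆ i : Fin n, esymRem n (k - 1) (eigs A) i * eigs A i / esym n k (eigs A)

/-- `ψ` is admissible on the open set `A` with respect to the cone `Γ`:
it is `C²` on `A` and `λ(D²ψ) ∈ Γ` there. -/
def Admissible {n : ℕ} (Γ : Set (Fin n → ℝ)) (A : Set (EuclideanSpace ℝ (Fin n)))
    (ψ : EuclideanSpace ℝ (Fin n) → ℝ) : Prop :=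
  ContDiffOn ℝ 2 ψ A ∧ ∀ x ∈ A, eigs (hessianMatrix ψ x) ∈ Γ

/-- Viscosity subsolution of `F(D²u) = g` on `Ω` (for `F` of the form `f(λ(D²u))`). -/
def ViscSubsolution {n : ℕ} (Γ : Set (Fin n → ℝ)) (F : Matrix (Fin n) (Fin n) ℝ → ℝ)
    (g : EuclideanSpace ℝ (Fin n) → ℝ) (Ω : Set (EuclideanSpace ℝ (Fin n)))
    (u : EuclideanSpace ℝ (Fin n) → ℝ) : Prop :=
  UpperSemicontinuousOn u Ω ∧
    ∀ Aset : Set (EuclideanSpace ℝ (Fin n)), Aset ⊆ Ω → IsOpen Aset →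
      ∀ ψ : EuclideanSpace ℝ (Fin n) → ℝ, Admissible Γ Aset ψ →
        ∀ x₀ ∈ Aset, IsLocalMaxOn (fun y => u y - ψ y) Aset x₀ →
          g x₀ ≤ F (hessianMatrix ψ x₀)

/-- Viscosity supersolution of `F(D²u) = g` on `Ω`. -/
def ViscSupersolution {n : ℕ} (Γ : Set (Fin n → ℝ)) (F : Matrix (Fin n) (Fin n) ℝ → ℝ)
    (g : EuclideanSpace ℝ (Fin n) → ℝ) (Ω : Set (EuclideanSpace ℝ (Fin n)))
    (u : EuclideanSpace ℝ (Fin n) → ℝ) : Prop :=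
  LowerSemicontinuousOn u Ω ∧
    ∀ Aset : Set (EuclideanSpace ℝ (Fin n)), Aset ⊆ Ω → IsOpen Aset →
      ∀ ψ : EuclideanSpace ℝ (Fin n) → ℝ, Admissible Γ Aset ψ →
        ∀ x₀ ∈ Aset, IsLocalMinOn (fun y => u y - ψ y) Aset x₀ →
          F (hessianMatrix ψ x₀) ≤ g x₀

end

/-- `ḡ(t) = 1 + C₀ t^{-β/2}`. -/
noncomputable def gbar (C₀ β t : ℝ) : ℝ := 1 + C₀ * t ^ (-β / 2)

/-- `W(s) = ( s^{-ℋ} ( ∫₁ˢ ℋ t^{ℋ-1} ḡ(t) dt + c₁ ) )^{1/m}`. -/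
noncomputable def Wsub (m : ℕ) (Hc C₀ β c₁ : ℝ) (s : ℝ) : ℝ :=
  (s ^ (-Hc) * ((∫ t in (1:ℝ)..s, Hc * t ^ (Hc - 1) * gbar C₀ β t) + c₁)) ^ ((1 : ℝ) / m)

/-- `w(s) = c₂ + ∫_{s₀}^s W(η) dη`. -/
noncomputable def wProfile (m : ℕ) (Hc C₀ β c₁ c₂ s₀ : ℝ) (s : ℝ) : ℝ :=
  c₂ + ∫ η in s₀..s, Wsub m Hc C₀ β c₁ η

/-- The generalized symmetric function `w_{c₁,c₂}(x) = w(½xᵀAx)`. -/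
noncomputable def wGSym (n : ℕ) (m : ℕ) (Hc C₀ β c₁ c₂ s₀ : ℝ)
    (A : Matrix (Fin n) (Fin n) ℝ) (x : EuclideanSpace ℝ (Fin n)) : ℝ :=
  wProfile m Hc C₀ β c₁ c₂ s₀ (quadForm A x)

open Polynomial in
/-- The generating polynomial `∏_{i ∈ s} (1 + λᵢ X)` of the elementary symmetric functions. -/
noncomputable def esymGen {ι : Type*} (s : Finset ι) (lam : ι → ℝ) : ℝ[X] := ∏ i ∈ s, (1 + C (lam i) * X)

open Polynomial in
lemma esymGen_coeff {ι : Type*} (s : Finset ι) (lam : ι → ℝ) (m : ℕ) :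
    (esymGen s lam).coeff m = ∑ S ∈ s.powersetCard m, ∏ i ∈ S, lam i := by
  classical
  have h : ∀ S ∈ s.powerset, ∏ i ∈ S, (C (lam i) * X) = C (∏ i ∈ S, lam i) * X ^ S.card := by
    intro S _
    rw [Finset.prod_mul_distrib, Finset.prod_const, map_prod]
  rw [esymGen, Finset.prod_one_add, Finset.sum_congr rfl h, finsetSum_coeff]
  simp only [coeff_C_mul_X_pow]
  rw [← Finset.sum_filter, Finset.powersetCard_eq_filter]
  simp only [eq_comm]

lemma esym_eq_coeff (n m : ℕ) (lam : Fin n → ℝ) :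
    esym n m lam = (esymGen Finset.univ lam).coeff m := (esymGen_coeff _ _ _).symm

open Polynomial in
lemma esymGen_erase {n : ℕ} (lam : Fin n → ℝ) (i : Fin n) :
    esymGen Finset.univ lam = esymGen (Finset.univ.erase i) lam * (1 + C (lam i) * X) :=
  (Finset.prod_erase_mul _ _ (Finset.mem_univ i)).symm

open Polynomial in
lemma esymRem_eq_coeff (n m : ℕ) (lam : Fin n → ℝ) (i : Fin n) :
    esymRem n m lam i = (esymGen (Finset.univ.erase i) lam).coeff m := by
  have h : esymGen (Finset.univ.erase i) (Function.update lam i 0)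
      = esymGen (Finset.univ.erase i) lam :=
    Finset.prod_congr rfl fun j hj => by
      rw [Function.update_of_ne (Finset.ne_of_mem_erase hj)]
  rw [esymRem, esym_eq_coeff, esymGen_erase _ i, h]
  simp

open Polynomial in
lemma coeff_succ_mul_one_add_C_mul_X (p : ℝ[X]) (a : ℝ) (m : ℕ) :
    (p * (1 + C a * X)).coeff (m + 1) = p.coeff (m + 1) + a * p.coeff m := by
  rw [mul_add, mul_one, coeff_add, mul_comm (C a) X, ← mul_assoc, coeff_mul_C, coeff_mul_X,
    mul_comm a]

lemma esym_succ (n m : ℕ) (lam : Fin n → ℝ) (i : Fin n) :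
    esym n (m + 1) lam = esymRem n (m + 1) lam i + lam i * esymRem n m lam i := by
  rw [esym_eq_coeff, esymGen_erase _ i, coeff_succ_mul_one_add_C_mul_X, esymRem_eq_coeff,
    esymRem_eq_coeff]

lemma esymRem_zero (n : ℕ) (lam : Fin n → ℝ) (i : Fin n) : esymRem n 0 lam i = 1 := by
  simp [esymRem, esym]

lemma esymRem_congr {n : ℕ} {a b : Fin n → ℝ} (h : ∀ m, esym n m a = esym n m b)
    {i i' : Fin n} (hi : a i = b i') (m : ℕ) : esymRem n m a i = esymRem n m b i' := by
  induction m with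
  | zero => rw [esymRem_zero, esymRem_zero]
  | succ m ih =>
    have h1 := esym_succ n m a i
    have h2 := esym_succ n m b i'
    rw [h, hi, ih] at h1
    linarith

lemma esymGen_coeff_nonneg {ι : Type*} (s : Finset ι) {lam : ι → ℝ} (h : ∀ i, 0 < lam i)
    (m : ℕ) : 0 ≤ (esymGen s lam).coeff m := by
  rw [esymGen_coeff]
  exact Finset.sum_nonneg fun S _ => Finset.prod_nonneg fun i _ => (h i).le

lemma esymGen_coeff_pos {ι : Type*} {s : Finset ι} {lam : ι → ℝ} (h : ∀ i, 0 < lam i)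
    {m : ℕ} (hm : m ≤ s.card) : 0 < (esymGen s lam).coeff m := by
  rw [esymGen_coeff]
  exact Finset.sum_pos (fun S _ => Finset.prod_pos fun i _ => h i)
    (Finset.powersetCard_nonempty.2 hm)

lemma esym_pos {n m : ℕ} {lam : Fin n → ℝ} (h : ∀ i, 0 < lam i) (hm : m ≤ n) :
    0 < esym n m lam := by
  rw [esym_eq_coeff]
  exact esymGen_coeff_pos h (by simpa using hm)

lemma esymRem_pos {n m : ℕ} {lam : Fin n → ℝ} (h : ∀ i, 0 < lam i) (hm : m < n) (i : Fin n) :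
    0 < esymRem n m lam i := by
  rw [esymRem_eq_coeff]
  refine esymGen_coeff_pos h ?_
  rw [Finset.card_erase_of_mem (Finset.mem_univ i), Finset.card_univ, Fintype.card_fin]
  omega

/-- Log-concavity of the elementary symmetric functions of positive numbers. -/
lemma esymGen_coeff_logConcave {ι : Type*} (s : Finset ι) {lam : ι → ℝ} (h : ∀ i, 0 < lam i) :
    ∀ i j : ℕ, i ≤ j → (esymGen s lam).coeff i * (esymGen s lam).coeff (j + 1)
      ≤ (esymGen s lam).coeff (i + 1) * (esymGen s lam).coeff j := by
  classical
  induction s using Finset.induction_on with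
  | empty => intro i j _; simp [esymGen, Polynomial.coeff_one]
  | insert x s hx ih =>
    intro i j hij
    have hmul : esymGen (insert x s) lam
        = esymGen s lam * (1 + Polynomial.C (lam x) * Polynomial.X) := by
      rw [esymGen, Finset.prod_insert hx, mul_comm]; rfl
    have hc := esymGen_coeff_nonneg s h
    have hx0 := (h x).le
    rw [hmul]
    set p := esymGen s lam
    rcases i with _ | i <;> rcases j with _ | j
    · exact (mul_comm _ _).le
    · have h0 : (p * (1 + Polynomial.C (lam x) * Polynomial.X)).coeff 0 = p.coeff 0 := by simp
      rw [h0]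
      simp only [coeff_succ_mul_one_add_C_mul_X]
      nlinarith [ih 0 (j + 1) hij, mul_nonneg hx0 (mul_nonneg (hc 1) (hc j)),
        mul_nonneg (mul_nonneg hx0 hx0) (mul_nonneg (hc 0) (hc j))]
    · omega
    · simp only [coeff_succ_mul_one_add_C_mul_X]
      have h1 := ih (i + 1) (j + 1) hij
      have h2 := ih i j (by omega)
      have h3 : p.coeff i * p.coeff (j + 2) ≤ p.coeff (i + 2) * p.coeff j := by
        rcases Nat.eq_or_lt_of_le hij with h' | h'
        · obtain rfl : i = j := by omega
          exact (mul_comm _ _).le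
        · exact (ih i (j + 1) (by omega)).trans (ih (i + 1) j (by omega))
      have h4 := mul_le_mul_of_nonneg_left h3 hx0
      have h5 := mul_le_mul_of_nonneg_left h2 (mul_nonneg hx0 hx0)
      simp only [add_assoc, Nat.reduceAdd] at *
      nlinarith

/-- The ratio `σ_{m-1;i} λᵢ / σ_m` is nondecreasing in `m`. -/
lemma esymRem_mul_esym_le {n m k : ℕ} {lam : Fin n → ℝ} (h : ∀ i, 0 < lam i) (hmk : m ≤ k)
    (i : Fin n) :
    esymRem n m lam i * esym n (k + 1) lam ≤ esymRem n k lam i * esym n (m + 1) lam := by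
  rw [esym_succ n k lam i, esym_succ n m lam i]
  simp only [esymRem_eq_coeff]
  linarith [esymGen_coeff_logConcave (Finset.univ.erase i) h m k hmk]

lemma eigs_prod_eq_det {n : ℕ} {M : Matrix (Fin n) (Fin n) ℝ} (hM : M.IsHermitian) (t : ℝ) :
    ∏ i, (t - eigs M i) = (Matrix.scalar (Fin n) t - M).det := by
  rw [← Matrix.eval_charpoly, hM.charpoly_eq, Polynomial.eval_prod, eigs, dif_pos hM]
  simp only [Function.comp_apply, Polynomial.eval_sub, Polynomial.eval_X, Polynomial.eval_C]
  exact Equiv.prod_comp (Tuple.sort hM.eigenvalues) fun i => t - hM.eigenvalues i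

lemma esymGen_eigs_eval {n : ℕ} {M : Matrix (Fin n) (Fin n) ℝ} (hM : M.IsHermitian) {t : ℝ}
    (ht : t ≠ 0) : (esymGen Finset.univ (eigs M)).eval t = (1 + t • M).det := by
  have h1 : 1 + t • M = (-t) • (Matrix.scalar (Fin n) (-t⁻¹) - M) := by
    ext i j
    by_cases hij : i = j
    · subst hij; simp [mul_sub, ht]
    · simp [hij]
  rw [h1, Matrix.det_smul, ← eigs_prod_eq_det hM, esymGen, Polynomial.eval_prod,
    ← Finset.card_univ, ← Finset.prod_const, ← Finset.prod_mul_distrib]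
  refine Finset.prod_congr rfl fun i _ => ?_
  simp only [Polynomial.eval_add, Polynomial.eval_one, Polynomial.eval_mul, Polynomial.eval_C,
    Polynomial.eval_X]
  field_simp
  ring

lemma det_diagonal_add_vecMulVec {n : ℕ} {e : Fin n → ℝ} (he : ∀ i, e i ≠ 0) (c : ℝ)
    (v : Fin n → ℝ) :
    (Matrix.diagonal e + c • Matrix.vecMulVec v v).det
      = ∏ i, e i + c * ∑ i, v i ^ 2 * ∏ j ∈ Finset.univ.erase i, e j := by
  have h1 : Matrix.diagonal e + c • Matrix.vecMulVec v v = Matrix.diagonal e *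
      (1 + Matrix.replicateCol Unit (fun i => v i / e i) *
        Matrix.replicateRow Unit (fun i => c * v i)) := by
    ext i j
    rw [mul_add, mul_one, Matrix.add_apply, Matrix.add_apply, Matrix.diagonal_mul]
    simp [Matrix.mul_apply, Matrix.vecMulVec_apply]
    field_simp [he i]
  rw [h1, Matrix.det_mul, Matrix.det_diagonal, Matrix.det_one_add_replicateCol_mul_replicateRow,
    mul_add, mul_one, dotProduct, Finset.mul_sum, Finset.mul_sum]
  congr 1
  refine Finset.sum_congr rfl fun i _ => ?_
  rw [← Finset.mul_prod_erase _ _ (Finset.mem_univ i)]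
  field_simp [he i]

/-- The elementary symmetric functions of a rank one perturbation of a diagonal matrix. -/
lemma esym_eigs_diagonal_add_vecMulVec {n : ℕ} {d : Fin n → ℝ} (hd : ∀ i, 0 < d i) (c : ℝ)
    (v : Fin n → ℝ) (m : ℕ) :
    esym n (m + 1) (eigs (Matrix.diagonal d + c • Matrix.vecMulVec v v))
      = esym n (m + 1) d + c * ∑ i, v i ^ 2 * esymRem n m d i := by
  have hM : (Matrix.diagonal d + c • Matrix.vecMulVec v v).IsHermitian := by
    ext i j
    by_cases hij : i = j
    · subst hij; simp
    · simp [Matrix.vecMulVec_apply, hij, Ne.symm hij, mul_comm (v i)]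
  have hp : esymGen Finset.univ (eigs (Matrix.diagonal d + c • Matrix.vecMulVec v v))
      = esymGen Finset.univ d + (Polynomial.C c * ∑ i, Polynomial.C (v i ^ 2) *
        esymGen (Finset.univ.erase i) d) * Polynomial.X := by
    refine Polynomial.eq_of_infinite_eval_eq _ _ ((Set.Ioi_infinite (0 : ℝ)).mono fun t ht => ?_)
    have ht : 0 < t := ht
    have h2 : 1 + t • (Matrix.diagonal d + c • Matrix.vecMulVec v v)
        = Matrix.diagonal (fun i => 1 + d i * t) + (t * c) • Matrix.vecMulVec v v := by
      ext i j
      by_cases hij : i = j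
      · subst hij; simp; ring
      · simp [hij]; ring
    rw [Set.mem_ofPred_eq, esymGen_eigs_eval hM ht.ne', h2,
      det_diagonal_add_vecMulVec fun i => by have := hd i; positivity]
    simp only [esymGen, Polynomial.eval_add, Polynomial.eval_mul, Polynomial.eval_C,
      Polynomial.eval_X, Polynomial.eval_finsetSum, Polynomial.eval_prod, Polynomial.eval_one]
    ring
  rw [esym_eq_coeff, hp, Polynomial.coeff_add, Polynomial.coeff_mul_X, Polynomial.coeff_C_mul,
    Polynomial.finsetSum_coeff, esym_eq_coeff]
  simp only [Polynomial.coeff_C_mul, esymRem_eq_coeff]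

lemma esym_zero (n : ℕ) (lam : Fin n → ℝ) : esym n 0 lam = 1 := by simp [esym]

lemma esym_eigs_diagonal {n : ℕ} {d : Fin n → ℝ} (hd : ∀ i, 0 < d i) (m : ℕ) :
    esym n m (eigs (Matrix.diagonal d)) = esym n m d := by
  cases m with
  | zero => rw [esym_zero, esym_zero]
  | succ m => simpa using esym_eigs_diagonal_add_vecMulVec hd 0 0 m

lemma exists_eigs_diagonal_eq {n : ℕ} (d : Fin n → ℝ) (i : Fin n) :
    ∃ i', eigs (Matrix.diagonal d) i' = d i := by
  have h := eigs_prod_eq_det (Matrix.isHermitian_diagonal d) (d i)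
  rw [Matrix.scalar_apply, Matrix.diagonal_sub, Matrix.det_diagonal] at h
  replace h := h.trans (Finset.prod_eq_zero (Finset.mem_univ i) (sub_self _))
  rw [Finset.prod_eq_zero_iff] at h
  obtain ⟨i', -, h'⟩ := h
  exact ⟨i', (sub_eq_zero.1 h').symm⟩

lemma le_Hk_diagonal {n : ℕ} (k : ℕ) {a : Fin n → ℝ} (ha : ∀ i, 0 < a i) (i : Fin n) :
    esymRem n (k - 1) a i * a i / esym n k a ≤ Hk n k (Matrix.diagonal a) := by
  obtain ⟨i', hi'⟩ := exists_eigs_diagonal_eq a i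
  rw [← hi', ← esym_eigs_diagonal ha k,
    ← esymRem_congr (esym_eigs_diagonal ha) hi' (k - 1)]
  exact le_ciSup (f := fun i => esymRem n (k - 1) (eigs (Matrix.diagonal a)) i *
    eigs (Matrix.diagonal a) i / esym n k (eigs (Matrix.diagonal a))) (Set.finite_range _).bddAbove i'

lemma Hk_diagonal_pos {n k : ℕ} (hk : 1 ≤ k) (hkn : k ≤ n) {a : Fin n → ℝ}
    (ha : ∀ i, 0 < a i) : 0 < Hk n k (Matrix.diagonal a) := by
  have i : Fin n := ⟨0, by omega⟩
  refine lt_of_lt_of_le ?_ (le_Hk_diagonal k ha i)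
  exact div_pos (mul_pos (esymRem_pos ha (by omega) i) (ha i)) (esym_pos ha hkn)

lemma esymRem_mul_le_Hk {n m k : ℕ} (hmk : m + 1 ≤ k) (hkn : k ≤ n) {a : Fin n → ℝ}
    (ha : ∀ i, 0 < a i) (i : Fin n) :
    esymRem n m a i * a i ≤ Hk n k (Matrix.diagonal a) * esym n (m + 1) a := by
  obtain ⟨k, rfl⟩ : ∃ k', k = k' + 1 := ⟨k - 1, by omega⟩
  have h1 := le_Hk_diagonal (k + 1) ha i
  have hk := esym_pos ha hkn
  rw [div_le_iff₀ hk, Nat.add_sub_cancel] at h1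
  have hm : 0 < esym n (m + 1) a := esym_pos ha (by omega)
  have h2 := mul_le_mul_of_nonneg_left
    (esymRem_mul_esym_le ha (show m ≤ k by omega) i) (ha i).le
  have h3 := mul_le_mul_of_nonneg_right h1 hm.le
  refine le_of_mul_le_mul_right ?_ hk
  nlinarith

lemma esym_const_mul (n m : ℕ) (c : ℝ) (lam : Fin n → ℝ) :
    esym n m (fun i => c * lam i) = c ^ m * esym n m lam := by
  rw [esym, esym, Finset.mul_sum]
  refine Finset.sum_congr rfl fun S hS => ?_
  rw [Finset.prod_mul_distrib, Finset.prod_const, (Finset.mem_powersetCard.1 hS).2]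

lemma esymRem_const_mul (n m : ℕ) (c : ℝ) (lam : Fin n → ℝ) (i : Fin n) :
    esymRem n m (fun i => c * lam i) i = c ^ m * esymRem n m lam i := by
  rw [esymRem, esymRem, ← esym_const_mul]
  congr 1
  ext j
  by_cases h : j = i
  · subst h; simp
  · simp [h]

lemma quadForm_diagonal {n : ℕ} (a : Fin n → ℝ) (x : EuclideanSpace ℝ (Fin n)) :
    quadForm (Matrix.diagonal a) x = (1 / 2) * ∑ i, a i * x i ^ 2 := by
  simp only [quadForm, Matrix.diagonal_apply, ite_mul, zero_mul, Finset.sum_ite_eq,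
    Finset.mem_univ, if_true]
  congr 1
  exact Finset.sum_congr rfl fun i _ => by ring

lemma hasFDerivAt_coord {n : ℕ} (x : EuclideanSpace ℝ (Fin n)) (i : Fin n) :
    HasFDerivAt (fun y : EuclideanSpace ℝ (Fin n) => y i)
      (EuclideanSpace.proj i : EuclideanSpace ℝ (Fin n) →L[ℝ] ℝ) x :=
  (EuclideanSpace.proj i : EuclideanSpace ℝ (Fin n) →L[ℝ] ℝ).hasFDerivAt

lemma hasFDerivAt_quadForm_diagonal {n : ℕ} (a : Fin n → ℝ) (x : EuclideanSpace ℝ (Fin n)) :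
    HasFDerivAt (quadForm (Matrix.diagonal a))
      (∑ i, (a i * x i) • (EuclideanSpace.proj i : EuclideanSpace ℝ (Fin n) →L[ℝ] ℝ)) x := by
  have h : quadForm (Matrix.diagonal a) = fun x => (1 / 2) * ∑ i, a i * x i ^ 2 :=
    funext (quadForm_diagonal a)
  rw [h]
  have h1 := (HasFDerivAt.fun_sum (u := Finset.univ) fun i _ =>
    ((hasFDerivAt_coord x i).pow 2).const_mul (a i)).const_mul (1 / 2 : ℝ)
  refine h1.congr_fderiv ?_
  rw [Finset.smul_sum]
  refine Finset.sum_congr rfl fun i _ => ?_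
  rw [smul_smul, smul_smul]
  congr 1
  simp
  ring

lemma sum_smul_proj_single {n : ℕ} (b : Fin n → ℝ) (j : Fin n) :
    (∑ i, b i • (EuclideanSpace.proj i : EuclideanSpace ℝ (Fin n) →L[ℝ] ℝ))
      (EuclideanSpace.single j 1) = b j := by
  simp

lemma hessianMatrix_comp_quadForm {n : ℕ} (a : Fin n → ℝ) {f F : ℝ → ℝ} {F' : ℝ}
    (x : EuclideanSpace ℝ (Fin n))
    (hf : ∀ᶠ s in nhds (quadForm (Matrix.diagonal a) x), HasDerivAt f (F s) s)
    (hF : HasDerivAt F F' (quadForm (Matrix.diagonal a) x)) :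
    hessianMatrix (fun y => f (quadForm (Matrix.diagonal a) y)) x
      = Matrix.diagonal (fun i => F (quadForm (Matrix.diagonal a) x) * a i)
        + F' • Matrix.vecMulVec (fun i => a i * x i) (fun i => a i * x i) := by
  ext i j
  have hq := hasFDerivAt_quadForm_diagonal a x
  have h1 : (fun y => fderiv ℝ (fun y => f (quadForm (Matrix.diagonal a) y)) y
      (EuclideanSpace.single j 1)) =ᶠ[nhds x]
      fun y => F (quadForm (Matrix.diagonal a) y) * (a j * y j) := by
    filter_upwards [hq.continuousAt.eventually hf] with y hy
    have h := (hy.comp_hasFDerivAt y (hasFDerivAt_quadForm_diagonal a y)).fderiv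
    rw [Function.comp_def] at h
    rw [h, smul_apply, sum_smul_proj_single, smul_eq_mul]
  have h2 := (hF.comp_hasFDerivAt x hq).mul ((hasFDerivAt_coord x j).const_mul (a j))
  rw [hessianMatrix, h1.fderiv_eq]
  erw [h2.fderiv]
  simp only [add_apply, smul_apply,
    sum_smul_proj_single, smul_eq_mul, Matrix.add_apply, Matrix.smul_apply,
    Matrix.vecMulVec_apply, Function.comp_apply]
  by_cases hij : i = j
  · subst hij; simp; ring
  · simp [hij, Ne.symm hij]; ring

section Profile

variable {p : ℕ} {H C₀ β c₁ : ℝ}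

lemma continuousAt_integrand (H C₀ β : ℝ) {t : ℝ} (ht : 0 < t) :
    ContinuousAt (fun t => H * t ^ (H - 1) * gbar C₀ β t) t := by
  unfold gbar
  exact (continuousAt_const.mul (Real.continuousAt_rpow_const _ _ (Or.inl ht.ne'))).mul
    (continuousAt_const.add
      (continuousAt_const.mul (Real.continuousAt_rpow_const _ _ (Or.inl ht.ne'))))

lemma hasDerivAt_integral_of_continuousOn_Ioi {f : ℝ → ℝ} (hf : ∀ t, 0 < t → ContinuousAt f t)
    {b s : ℝ} (hb : 0 < b) (hs : 0 < s) :
    HasDerivAt (fun u => ∫ t in b..u, f t) (f s) s := by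
  refine intervalIntegral.integral_hasDerivAt_right ?_ ?_ (hf s hs)
  · exact ContinuousOn.intervalIntegrable fun t ht =>
      (hf t ((lt_min hb hs).trans_le ht.1)).continuousWithinAt
  · exact ContinuousOn.stronglyMeasurableAtFilter isOpen_Ioi
      (fun t ht => (hf t ht).continuousWithinAt) s hs

/-- The base `Y(s) = s^{-ℋ} (∫₁ˢ ℋ t^{ℋ-1} ḡ(t) dt + c₁)` of the power defining `Wsub`. -/
noncomputable def profileBase (H C₀ β c₁ s : ℝ) : ℝ :=
  s ^ (-H) * ((∫ t in (1:ℝ)..s, H * t ^ (H - 1) * gbar C₀ β t) + c₁)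

lemma hasDerivAt_profileBase {s : ℝ} (hs : 0 < s) :
    HasDerivAt (profileBase H C₀ β c₁)
      (H / s * (gbar C₀ β s - profileBase H C₀ β c₁ s)) s := by
  have h := (Real.hasDerivAt_rpow_const (p := -H) (Or.inl hs.ne')).mul
    ((hasDerivAt_integral_of_continuousOn_Ioi
      (fun t ht => continuousAt_integrand H C₀ β ht) one_pos hs).add_const c₁)
  refine h.congr_deriv ?_
  have h1 : s ^ (-H) * s ^ (H - 1) = s⁻¹ := by
    rw [← Real.rpow_add hs, ← Real.rpow_neg_one]; congr 1; ring
  rw [Real.rpow_sub_one hs.ne', profileBase]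
  calc _ = -H * (s ^ (-H) / s) * ((∫ t in (1:ℝ)..s, H * t ^ (H - 1) * gbar C₀ β t) + c₁)
      + H * (s ^ (-H) * s ^ (H - 1)) * gbar C₀ β s := by ring
    _ = _ := by rw [h1]; ring

lemma gbar_le_profileBase (hH : 0 < H) (hβ : 0 < β) (hC₀ : 0 < C₀) (hc : 1 + C₀ ≤ c₁)
    {s : ℝ} (hs : 1 ≤ s) : gbar C₀ β s ≤ profileBase H C₀ β c₁ s := by
  have hs0 : 0 < s := one_pos.trans_le hs
  have hanti : ∀ t, 1 ≤ t → t ≤ s → gbar C₀ β s ≤ gbar C₀ β t := fun t ht hts => by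
    unfold gbar
    gcongr 1 + C₀ * ?_
    exact Real.rpow_le_rpow_of_nonpos (by linarith) hts (by linarith)
  have hg1 : gbar C₀ β s ≤ c₁ := (hanti 1 le_rfl hs).trans (by simpa [gbar] using hc)
  have h1 : gbar C₀ β s * (s ^ H - 1) ≤ ∫ t in (1:ℝ)..s, H * t ^ (H - 1) * gbar C₀ β t := by
    have h2 : ∫ t in (1:ℝ)..s, H * t ^ (H - 1) * gbar C₀ β s = gbar C₀ β s * (s ^ H - 1) := by
      rw [intervalIntegral.integral_mul_const, intervalIntegral.integral_const_mul,
        integral_rpow (Or.inl (by linarith)), sub_add_cancel, Real.one_rpow]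
      field_simp
    rw [← h2]
    refine intervalIntegral.integral_mono_on hs ?_ ?_ fun t ht => ?_
    · exact ContinuousOn.intervalIntegrable_of_Icc hs fun t ht =>
        ((continuousAt_const.mul (Real.continuousAt_rpow_const _ _
          (Or.inl (one_pos.trans_le ht.1).ne'))).mul continuousAt_const).continuousWithinAt
    · exact ContinuousOn.intervalIntegrable_of_Icc hs fun t ht =>
        (continuousAt_integrand H C₀ β (one_pos.trans_le ht.1)).continuousWithinAt
    · have : 0 ≤ t ^ (H - 1) := Real.rpow_nonneg (by linarith [ht.1]) _
      exact mul_le_mul_of_nonneg_left (hanti t ht.1 ht.2) (by positivity)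
  have h3 : 0 < s ^ (-H) := Real.rpow_pos_of_pos hs0 _
  have h4 : s ^ (-H) * s ^ H = 1 := by rw [← Real.rpow_add hs0]; simp
  calc gbar C₀ β s = s ^ (-H) * (gbar C₀ β s * s ^ H) := by
        rw [mul_left_comm, h4, mul_one]
    _ ≤ _ := mul_le_mul_of_nonneg_left (by linarith) h3.le

lemma hasDerivAt_Wsub {s : ℝ} (hs : 0 < s) (hY : 0 < profileBase H C₀ β c₁ s) :
    HasDerivAt (Wsub p H C₀ β c₁) (Wsub p H C₀ β c₁ s * (H / (p * s)) *
      (gbar C₀ β s / profileBase H C₀ β c₁ s - 1)) s := by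
  have h := (hasDerivAt_profileBase (H := H) (C₀ := C₀) (β := β) (c₁ := c₁) hs).rpow_const
    (p := (1 : ℝ) / p) (Or.inl hY.ne')
  refine h.congr_deriv ?_
  rw [Real.rpow_sub_one hY.ne']
  change _ = profileBase H C₀ β c₁ s ^ ((1 : ℝ) / p) * _ * _
  field_simp

lemma continuousAt_Wsub {s : ℝ} (hs : 0 < s) : ContinuousAt (Wsub p H C₀ β c₁) s :=
  (hasDerivAt_profileBase hs).continuousAt.rpow_const (Or.inr (by positivity))

lemma hasDerivAt_wProfile {c₂ s₀ s : ℝ} (hs₀ : 0 < s₀) (hs : 0 < s) :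
    HasDerivAt (wProfile p H C₀ β c₁ c₂ s₀) (Wsub p H C₀ β c₁ s) s :=
  (hasDerivAt_integral_of_continuousOn_Ioi (fun _ ht => continuousAt_Wsub ht) hs₀ hs).const_add c₂

end Profile

/-- **Part (b) of Subsection 2.2 (uniform k-convexity, inequality (2.7))**: for diagonal
`A ∈ 𝒜_{k,l}` there is `C̃ > 1` such that for `c₁ > C̃` and every `c₂`, on `{½xᵀAx ≥ 1}`,
`σ_m(λ(D²w_{c₁,c₂})) ≥ σ_m(λ(A)) (w')^{m-1}(w' + 2H_k(A) w'' s) > 0` for `1 ≤ m ≤ k`;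
in particular `w_{c₁,c₂}` is uniformly `k`-convex there. -/
theorem gsym_subsolution_uniformly_k_convex
    (n k l : ℕ) (hn : 3 ≤ n) (hlk : l < k) (hkn : k ≤ n)
    (a : Fin n → ℝ) (hApd : (Matrix.diagonal a).PosDef)
    (hA1 : Skl n k l (Matrix.diagonal a) = 1)
    (β C₀ s₀ : ℝ) (hβ : 0 < β) (hC₀ : 0 < C₀) (hs₀ : 1 < s₀) :
    ∃ Ct : ℝ, 1 < Ct ∧ ∀ c₁ : ℝ, Ct < c₁ → ∀ c₂ : ℝ,
      ∀ x : EuclideanSpace ℝ (Fin n), 1 ≤ quadForm (Matrix.diagonal a) x →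
        (∀ m : ℕ, 1 ≤ m → m ≤ k →
          esym n m a *
              (Wsub (k - l) (((k : ℝ) - l) / (2 * Hk n k (Matrix.diagonal a))) C₀ β c₁
                  (quadForm (Matrix.diagonal a) x)) ^ (m - 1) *
              (Wsub (k - l) (((k : ℝ) - l) / (2 * Hk n k (Matrix.diagonal a))) C₀ β c₁
                  (quadForm (Matrix.diagonal a) x) +
                2 * Hk n k (Matrix.diagonal a) *
                  deriv (Wsub (k - l) (((k : ℝ) - l) / (2 * Hk n k (Matrix.diagonal a))) C₀ β c₁)
                    (quadForm (Matrix.diagonal a) x) *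
                  quadForm (Matrix.diagonal a) x) ≤
            esym n m (eigs (hessianMatrix
              (wGSym n (k - l) (((k : ℝ) - l) / (2 * Hk n k (Matrix.diagonal a))) C₀ β c₁ c₂ s₀
                (Matrix.diagonal a)) x)) ∧
          0 < esym n m a *
              (Wsub (k - l) (((k : ℝ) - l) / (2 * Hk n k (Matrix.diagonal a))) C₀ β c₁
                  (quadForm (Matrix.diagonal a) x)) ^ (m - 1) *
              (Wsub (k - l) (((k : ℝ) - l) / (2 * Hk n k (Matrix.diagonal a))) C₀ β c₁
                  (quadForm (Matrix.diagonal a) x) +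
                2 * Hk n k (Matrix.diagonal a) *
                  deriv (Wsub (k - l) (((k : ℝ) - l) / (2 * Hk n k (Matrix.diagonal a))) C₀ β c₁)
                    (quadForm (Matrix.diagonal a) x) *
                  quadForm (Matrix.diagonal a) x)) ∧
        eigs (hessianMatrix
            (wGSym n (k - l) (((k : ℝ) - l) / (2 * Hk n k (Matrix.diagonal a))) C₀ β c₁ c₂ s₀
              (Matrix.diagonal a)) x) ∈ GammaK n k := by
  have ha : ∀ i, 0 < a i := Matrix.posDef_diagonal_iff.1 hApd
  have hHk : 0 < Hk n k (Matrix.diagonal a) := Hk_diagonal_pos (by omega) hkn ha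
  have hp : (0 : ℝ) < (k : ℝ) - l := sub_pos.2 (by exact_mod_cast hlk)
  have hpc : ((k - l : ℕ) : ℝ) = (k : ℝ) - l := Nat.cast_sub hlk.le
  refine ⟨1 + C₀, by linarith, fun c₁ hc₁ c₂ x hx => ?_⟩
  set Hc := ((k : ℝ) - l) / (2 * Hk n k (Matrix.diagonal a)) with hHc
  set s := quadForm (Matrix.diagonal a) x with hs
  have hHc0 : 0 < Hc := by positivity
  have hs0 : 0 < s := one_pos.trans_le hx
  have hg : 0 < gbar C₀ β s := by
    have := Real.rpow_pos_of_pos hs0 (-β / 2)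
    unfold gbar
    positivity
  have hgY : gbar C₀ β s ≤ profileBase Hc C₀ β c₁ s :=
    gbar_le_profileBase hHc0 hβ hC₀ hc₁.le hx
  have hY : 0 < profileBase Hc C₀ β c₁ s := hg.trans_le hgY
  have hW : 0 < Wsub (k - l) Hc C₀ β c₁ s := Real.rpow_pos_of_pos hY _
  have hdW := hasDerivAt_Wsub (p := k - l) hs0 hY
  have hdW0 : deriv (Wsub (k - l) Hc C₀ β c₁) s ≤ 0 := by
    rw [hdW.deriv, hpc]
    exact mul_nonpos_of_nonneg_of_nonpos (by positivity)
      (sub_nonpos.2 ((div_le_one hY).2 hgY))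
  have hfac : Wsub (k - l) Hc C₀ β c₁ s + 2 * Hk n k (Matrix.diagonal a) *
      deriv (Wsub (k - l) Hc C₀ β c₁) s * s
      = Wsub (k - l) Hc C₀ β c₁ s * (gbar C₀ β s / profileBase Hc C₀ β c₁ s) := by
    have h1 : 2 * Hk n k (Matrix.diagonal a) * Hc = (k : ℝ) - l := by rw [hHc]; field_simp
    have h2 : 2 * Hk n k (Matrix.diagonal a) * (Hc / (((k : ℝ) - l) * s)) * s = 1 := by
      rw [← mul_div_assoc, h1]
      field_simp
    rw [hdW.deriv, hpc]
    linear_combination Wsub (k - l) Hc C₀ β c₁ s *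
      (gbar C₀ β s / profileBase Hc C₀ β c₁ s - 1) * h2
  have hhess : hessianMatrix (wGSym n (k - l) Hc C₀ β c₁ c₂ s₀ (Matrix.diagonal a)) x = _ :=
    hessianMatrix_comp_quadForm a x
      ((lt_mem_nhds hs0).mono fun _ ht => hasDerivAt_wProfile (one_pos.trans hs₀) ht)
      hdW.differentiableAt.hasDerivAt
  rw [← hs] at hhess
  set W := Wsub (k - l) Hc C₀ β c₁ s
  set W' := deriv (Wsub (k - l) Hc C₀ β c₁) s
  have key : ∀ m : ℕ, 1 ≤ m → m ≤ k →
      esym n m a * W ^ (m - 1) * (W + 2 * Hk n k (Matrix.diagonal a) * W' * s) ≤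
        esym n m (eigs (hessianMatrix
          (wGSym n (k - l) Hc C₀ β c₁ c₂ s₀ (Matrix.diagonal a)) x)) ∧
      0 < esym n m a * W ^ (m - 1) * (W + 2 * Hk n k (Matrix.diagonal a) * W' * s) := by
    intro m hm hmk
    obtain ⟨m, rfl⟩ : ∃ m', m = m' + 1 := ⟨m - 1, by omega⟩
    refine ⟨?_, ?_⟩
    · rw [hhess, esym_eigs_diagonal_add_vecMulVec fun i => mul_pos hW (ha i)]
      simp only [esymRem_const_mul, esym_const_mul, Nat.add_sub_cancel]
      have hsum : ∑ i, (a i * x i) ^ 2 * (W ^ m * esymRem n m a i)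
          ≤ W ^ m * (2 * Hk n k (Matrix.diagonal a) * esym n (m + 1) a * s) := by
        rw [hs, quadForm_diagonal]
        calc _ = W ^ m * ∑ i, a i * x i ^ 2 * (esymRem n m a i * a i) := by
              rw [Finset.mul_sum]
              exact Finset.sum_congr rfl fun i _ => by ring
          _ ≤ W ^ m * ∑ i, a i * x i ^ 2 *
                (Hk n k (Matrix.diagonal a) * esym n (m + 1) a) := by
              refine mul_le_mul_of_nonneg_left (Finset.sum_le_sum fun i _ => ?_) (by positivity)
              exact mul_le_mul_of_nonneg_left (esymRem_mul_le_Hk hmk hkn ha i)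
                (mul_nonneg (ha i).le (sq_nonneg _))
          _ = _ := by rw [← Finset.sum_mul]; ring
      have h := mul_le_mul_of_nonpos_left hsum hdW0
      rw [pow_succ]
      linarith
    · rw [hfac]
      have := esym_pos ha (hmk.trans hkn)
      positivity
  exact ⟨key, fun m hm hmk => (key m hm hmk).2.trans_le (key m hm hmk).1⟩
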